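/- Let X₁,…,X_n be independent nonnegative random variables with finite expected maximum. Draw independent samples s₁,…,s_n (s_i ~ X_i) and set threshold τ = max_i s_i. Then the strategy that accepts the first realized value v_i > τ (in any order, even one chosen adversarially with knowledge of all realizations, provided the worst case is taken) satisfies E[ALG] ≥ (1/2) E[max_i X_i], where the worst-case order selects the smallest threshold-exceeding value. -/

import Mathlib

open MeasureTheory

/-- The threshold: the maximum of the `n` samples. -/
noncomputable def sampleThreshold (n : ℕ) (hn : 0 < n) (s : Fin n → ℝ) : ℝ :=
  Finset.univ.sup' (Finset.univ_nonempty_iff.mpr ⟨⟨0, hn⟩⟩) s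

/-- Worst-case (almighty-adversary) value of the single-sample algorithm:
given samples `s` and real values `r`, it receives the smallest real value
strictly exceeding the threshold `max_i s_i`, and `0` if none exists. -/
noncomputable def singleSampleAlg (n : ℕ) (hn : 0 < n)
    (p : (Fin n → ℝ) × (Fin n → ℝ)) : ℝ :=
  if h : (Finset.univ.filter
      (fun i => sampleThreshold n hn p.1 < p.2 i)).Nonempty then
    (Finset.univ.filter (fun i => sampleThreshold n hn p.1 < p.2 i)).inf' h p.2
  else 0

lemma sampleThreshold_le_iff {n : ℕ} (hn : 0 < n) (s : Fin n → ℝ) (t : ℝ) :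
    sampleThreshold n hn s ≤ t ↔ ∀ i, s i ≤ t := by
  simp [sampleThreshold]

lemma lt_sampleThreshold_iff {n : ℕ} (hn : 0 < n) (s : Fin n → ℝ) (t : ℝ) :
    t < sampleThreshold n hn s ↔ ∃ i, t < s i := by
  simp [sampleThreshold]

lemma exists_eq_sampleThreshold {n : ℕ} (hn : 0 < n) (s : Fin n → ℝ) :
    ∃ i, sampleThreshold n hn s = s i := by
  obtain ⟨i, -, hi⟩ := Finset.exists_mem_eq_sup'
    (Finset.univ_nonempty_iff.mpr ⟨⟨0, hn⟩⟩ : (Finset.univ : Finset (Fin n)).Nonempty) s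
  exact ⟨i, hi⟩

lemma measurable_sampleThreshold {n : ℕ} (hn : 0 < n) : Measurable (sampleThreshold n hn) := by
  refine measurable_of_Iic fun t => ?_
  have : sampleThreshold n hn ⁻¹' Set.Iic t = ⋂ i, {s | s i ≤ t} := by
    ext s; simp [sampleThreshold_le_iff]
  rw [this]
  exact MeasurableSet.iInter fun i => measurableSet_le (measurable_pi_apply i) measurable_const

lemma lt_singleSampleAlg_iff {n : ℕ} (hn : 0 < n) (p : (Fin n → ℝ) × (Fin n → ℝ)) (t : ℝ) :
    t < singleSampleAlg n hn p ↔
      (sampleThreshold n hn p.1 < sampleThreshold n hn p.2 ∧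
        ∀ i, sampleThreshold n hn p.1 < p.2 i → t < p.2 i) ∨
      (¬ sampleThreshold n hn p.1 < sampleThreshold n hn p.2 ∧ t < 0) := by
  have hne : (Finset.univ.filter (fun i => sampleThreshold n hn p.1 < p.2 i)).Nonempty ↔
      sampleThreshold n hn p.1 < sampleThreshold n hn p.2 := by
    rw [lt_sampleThreshold_iff hn p.2]
    simp [Finset.Nonempty]
  unfold singleSampleAlg
  split_ifs with h
  · have h' := hne.1 h
    simp only [h', Finset.lt_inf'_iff]
    simp
  · have h' := mt hne.2 h
    simp [h']

lemma measurable_singleSampleAlg {n : ℕ} (hn : 0 < n) : Measurable (singleSampleAlg n hn) := by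
  refine measurable_of_Ioi fun t => ?_
  have hM := measurable_sampleThreshold hn
  have h1 : MeasurableSet {p : (Fin n → ℝ) × (Fin n → ℝ) |
      sampleThreshold n hn p.1 < sampleThreshold n hn p.2} :=
    measurableSet_lt (hM.comp measurable_fst) (hM.comp measurable_snd)
  have h2 (i : Fin n) : MeasurableSet {p : (Fin n → ℝ) × (Fin n → ℝ) |
      sampleThreshold n hn p.1 < p.2 i} :=
    measurableSet_lt (hM.comp measurable_fst) ((measurable_pi_apply i).comp measurable_snd)
  have h3 (i : Fin n) : MeasurableSet {p : (Fin n → ℝ) × (Fin n → ℝ) | t < p.2 i} :=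
    measurableSet_lt measurable_const ((measurable_pi_apply i).comp measurable_snd)
  have : singleSampleAlg n hn ⁻¹' Set.Ioi t =
      {p : (Fin n → ℝ) × (Fin n → ℝ) |
        (sampleThreshold n hn p.1 < sampleThreshold n hn p.2 ∧
          ∀ i, sampleThreshold n hn p.1 < p.2 i → t < p.2 i) ∨
        (¬ sampleThreshold n hn p.1 < sampleThreshold n hn p.2 ∧ t < 0)} := by
    ext p; exact lt_singleSampleAlg_iff hn p t
  rw [this]
  have h4 : MeasurableSet {p : (Fin n → ℝ) × (Fin n → ℝ) |
      ∀ i, sampleThreshold n hn p.1 < p.2 i → t < p.2 i} := by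
    simp only [Set.ofPred_forall]
    exact MeasurableSet.iInter fun i => (h2 i).himp (h3 i)
  exact (h1.inter h4).union (h1.compl.inter (MeasurableSet.const _))

lemma singleSampleAlg_eq_zero_or_mem {n : ℕ} (hn : 0 < n) (p : (Fin n → ℝ) × (Fin n → ℝ)) :
    singleSampleAlg n hn p = 0 ∨ ∃ i, singleSampleAlg n hn p = p.2 i := by
  unfold singleSampleAlg
  split_ifs with h
  · obtain ⟨i, -, hi⟩ := Finset.exists_mem_eq_inf' h p.2
    exact Or.inr ⟨i, hi⟩
  · exact Or.inl rfl

lemma le_sampleThreshold {n : ℕ} (hn : 0 < n) (s : Fin n → ℝ) (i : Fin n) :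
    s i ≤ sampleThreshold n hn s :=
  (sampleThreshold_le_iff hn s _).1 le_rfl i

lemma measurableSet_forall_le_or_lt {n : ℕ} (hn : 0 < n) (t : ℝ) :
    MeasurableSet {p : (Fin n → ℝ) × (Fin n → ℝ) | sampleThreshold n hn p.1 ≤ t ∧
      ∀ i, p.2 i ≤ sampleThreshold n hn p.1 ∨ t < p.2 i} := by
  have hM : Measurable fun p : (Fin n → ℝ) × (Fin n → ℝ) => sampleThreshold n hn p.1 :=
    (measurable_sampleThreshold hn).comp measurable_fst
  have hv (i : Fin n) : Measurable fun p : (Fin n → ℝ) × (Fin n → ℝ) => p.2 i :=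
    (measurable_pi_apply i).comp measurable_snd
  simp only [Set.ofPred_and, Set.ofPred_forall, Set.ofPred_or]
  exact (measurableSet_le hM measurable_const).inter (MeasurableSet.iInter fun i =>
    (measurableSet_le (hv i) hM).union (measurableSet_lt measurable_const (hv i)))

/-- Two independent copies of a random variable, both landing in `T`, are in a given weak order
with probability at least half. -/
lemma sq_measureReal_le_two_mul_prod {Ω : Type*} [MeasurableSpace Ω] (P : Measure Ω)
    [IsProbabilityMeasure P] {f : Ω → ℝ} (hf : Measurable f) {T : Set ℝ} (hT : MeasurableSet T) :
    P.real (f ⁻¹' T) ^ 2 ≤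
      2 * (P.prod P).real {p | f p.2 ≤ f p.1 ∧ f p.1 ∈ T ∧ f p.2 ∈ T} := by
  set C := {p : Ω × Ω | f p.2 ≤ f p.1 ∧ f p.1 ∈ T ∧ f p.2 ∈ T} with hC
  have hCm : MeasurableSet C :=
    (measurableSet_le (hf.comp measurable_snd) (hf.comp measurable_fst)).inter
      (((hf.comp measurable_fst) hT).inter ((hf.comp measurable_snd) hT))
  have hswap : (P.prod P).real (Prod.swap ⁻¹' C) = (P.prod P).real C :=
    (Measure.measurePreserving_swap (μ := P) (ν := P)).measureReal_preimage hCm.nullMeasurableSet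
  have hsub : (f ⁻¹' T) ×ˢ (f ⁻¹' T) ⊆ C ∪ Prod.swap ⁻¹' C := by
    rintro ⟨a, b⟩ ⟨ha, hb⟩
    rcases le_total (f b) (f a) with h | h
    · exact Or.inl ⟨h, ha, hb⟩
    · exact Or.inr ⟨h, hb, ha⟩
  calc P.real (f ⁻¹' T) ^ 2 = (P.prod P).real ((f ⁻¹' T) ×ˢ (f ⁻¹' T)) := by
        rw [measureReal_prod_prod, sq]
    _ ≤ (P.prod P).real (C ∪ Prod.swap ⁻¹' C) := measureReal_mono hsub
    _ ≤ (P.prod P).real C + (P.prod P).real (Prod.swap ⁻¹' C) := measureReal_union_le _ _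
    _ = 2 * (P.prod P).real C := by rw [hswap]; ring

section

variable {n : ℕ} (hn : 0 < n) (μ : Fin n → Measure ℝ) [∀ i, IsProbabilityMeasure (μ i)]

/-- Independent copies of the maximum of atomless variables almost surely differ. -/
lemma prod_pi_sampleThreshold_eq_null [∀ i, NullSingletonClass (μ i)] :
    ((Measure.pi μ).prod (Measure.pi μ))
      {p | sampleThreshold n hn p.2 = sampleThreshold n hn p.1} = 0 := by
  have hM := measurable_sampleThreshold hn
  have hE : MeasurableSet {p : (Fin n → ℝ) × (Fin n → ℝ) |
      sampleThreshold n hn p.2 = sampleThreshold n hn p.1} :=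
    measurableSet_eq_fun (hM.comp measurable_snd) (hM.comp measurable_fst)
  rw [Measure.measure_prod_null hE]
  refine Filter.Eventually.of_forall fun s => ?_
  have hsub : Prod.mk s ⁻¹' {p : (Fin n → ℝ) × (Fin n → ℝ) |
      sampleThreshold n hn p.2 = sampleThreshold n hn p.1} ⊆
      ⋃ i, Function.eval i ⁻¹' {sampleThreshold n hn s} := by
    intro r hr
    obtain ⟨i, hi⟩ := exists_eq_sampleThreshold hn r
    exact Set.mem_iUnion.2 ⟨i, hi.symm.trans hr⟩
  refine measure_mono_null hsub (measure_iUnion_null fun i => ?_)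
  rw [(measurePreserving_eval μ i).measure_preimage (measurableSet_singleton _).nullMeasurableSet]
  exact measure_singleton _

/-- Allowing coordinates to exceed `t` as well raises the probability that all of them are at most
`m` by a factor of at least the inverse of the probability that all are at most `t`. -/
lemma pi_forall_le_le_mul {m t : ℝ} (hmt : m ≤ t) :
    (Measure.pi μ) {r | ∀ i, r i ≤ m} ≤
      (Measure.pi μ) {r | ∀ i, r i ≤ t} * (Measure.pi μ) {r | ∀ i, r i ≤ m ∨ t < r i} := by
  have e (S : Set ℝ) : {r : Fin n → ℝ | ∀ i, r i ∈ S} = Set.univ.pi fun _ => S := by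
    ext; simp
  have h1 := e (Set.Iic m)
  have h2 := e (Set.Iic t)
  have h3 := e (Set.Iic m ∪ Set.Ioi t)
  simp only [Set.mem_Iic, Set.mem_union, Set.mem_Ioi] at h1 h2 h3
  rw [h1, h2, h3, Measure.pi_pi, Measure.pi_pi, Measure.pi_pi, ← Finset.prod_mul_distrib]
  refine Finset.prod_le_prod' fun i _ => ?_
  have hu : (μ i).real (Set.Iic m ∪ Set.Ioi t) = (μ i).real (Set.Iic m) + (μ i).real (Set.Ioi t) :=
    measureReal_union (Set.Iic_disjoint_Ioi hmt) measurableSet_Ioi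
  have hc : (μ i).real (Set.Ioi t) = 1 - (μ i).real (Set.Iic t) := by
    rw [← Set.compl_Iic, probReal_compl_eq_one_sub measurableSet_Iic]
  have hle : (μ i).real (Set.Iic m) ≤ (μ i).real (Set.Iic t) :=
    measureReal_mono (Set.Iic_subset_Iic.2 hmt)
  have h1 : (μ i).real (Set.Iic t) ≤ 1 := measureReal_le_one
  have key : (μ i).real (Set.Iic m) ≤
      (μ i).real (Set.Iic t) * (μ i).real (Set.Iic m ∪ Set.Ioi t) := by
    rw [hu, hc]
    nlinarith [mul_nonneg (sub_nonneg.2 h1) (sub_nonneg.2 hle)]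
  simp only [measureReal_def, ← ENNReal.toReal_mul] at key
  exact (ENNReal.toReal_le_toReal (measure_ne_top _ _)
    (ENNReal.mul_ne_top (measure_ne_top _ _) (measure_ne_top _ _))).1 key

/-- Integrated form of `pi_forall_le_le_mul`, with `m` the maximum of an independent sample that
does not exceed `t`. -/
lemma prod_pi_le_mul_prod_pi (t : ℝ) :
    ((Measure.pi μ).prod (Measure.pi μ)).real
        {p | sampleThreshold n hn p.2 ≤ sampleThreshold n hn p.1 ∧ sampleThreshold n hn p.1 ≤ t} ≤
      (Measure.pi μ).real {r | sampleThreshold n hn r ≤ t} *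
        ((Measure.pi μ).prod (Measure.pi μ)).real
          {p | sampleThreshold n hn p.1 ≤ t ∧
            ∀ i, p.2 i ≤ sampleThreshold n hn p.1 ∨ t < p.2 i} := by
  have hM := measurable_sampleThreshold hn
  have hC : MeasurableSet {p : (Fin n → ℝ) × (Fin n → ℝ) |
      sampleThreshold n hn p.2 ≤ sampleThreshold n hn p.1 ∧ sampleThreshold n hn p.1 ≤ t} :=
    (measurableSet_le (hM.comp measurable_snd) (hM.comp measurable_fst)).inter
      (measurableSet_le (hM.comp measurable_fst) measurable_const)
  have hB := measurableSet_forall_le_or_lt hn t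
  simp only [measureReal_def, ← ENNReal.toReal_mul]
  refine ENNReal.toReal_mono
    (ENNReal.mul_ne_top (measure_ne_top _ _) (measure_ne_top _ _)) ?_
  rw [Measure.prod_apply hC, Measure.prod_apply hB,
    ← lintegral_const_mul _ (measurable_measure_prodMk_left hB)]
  refine lintegral_mono fun s => ?_
  by_cases hs : sampleThreshold n hn s ≤ t
  · have := pi_forall_le_le_mul μ hs
    simpa [Set.preimage, sampleThreshold_le_iff hn _ (sampleThreshold n hn s),
      sampleThreshold_le_iff hn _ t, hs, (sampleThreshold_le_iff hn s t).1 hs] using this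
  · simp [Set.preimage, hs]

/-- The tail of the algorithm's reward is at least half the tail of the maximum. -/
lemma measureReal_lt_sampleThreshold_le [∀ i, NullSingletonClass (μ i)] {t : ℝ} :
    (Measure.pi μ).real {r | t < sampleThreshold n hn r} ≤
      2 * ((Measure.pi μ).prod (Measure.pi μ)).real {p | t < singleSampleAlg n hn p} := by
  have hM := measurable_sampleThreshold hn
  have hM1 : Measurable fun p : (Fin n → ℝ) × (Fin n → ℝ) => sampleThreshold n hn p.1 :=
    hM.comp measurable_fst
  have hM2 : Measurable fun p : (Fin n → ℝ) × (Fin n → ℝ) => sampleThreshold n hn p.2 :=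
    hM.comp measurable_snd
  set P := Measure.pi μ
  set M := sampleThreshold n hn with hMdef
  set A := {p : (Fin n → ℝ) × (Fin n → ℝ) | t < M p.1 ∧ M p.1 < M p.2}
  set C := {p : (Fin n → ℝ) × (Fin n → ℝ) | M p.2 ≤ M p.1 ∧ M p.1 ≤ t}
  set B := {p : (Fin n → ℝ) × (Fin n → ℝ) | M p.1 ≤ t ∧ ∀ i, p.2 i ≤ M p.1 ∨ t < p.2 i}
  have hCm : MeasurableSet C :=
    (measurableSet_le hM2 hM1).inter (measurableSet_le hM1 measurable_const)
  have hBm : MeasurableSet B := measurableSet_forall_le_or_lt hn t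
  set q := P.real {r | M r ≤ t}
  have hq : P.real {r | t < M r} = 1 - q := by
    rw [← probReal_compl_eq_one_sub (measurableSet_le hM measurable_const)]
    congr 1; ext r; simp
  have hq0 : 0 ≤ q := measureReal_nonneg
  have hq1 : q ≤ 1 := measureReal_le_one
  have hCq : q ^ 2 ≤ 2 * (P.prod P).real C := by
    refine (sq_measureReal_le_two_mul_prod P hM (measurableSet_Iic (a := t))).trans ?_
    gcongr
    · exact measure_ne_top _ _
    · rintro p ⟨h1, h2, -⟩; exact ⟨h1, h2⟩
  have hAq : (1 - q) ^ 2 ≤ 2 * (P.prod P).real A := by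
    rw [← hq]
    refine (sq_measureReal_le_two_mul_prod P hM (measurableSet_Ioi (a := t))).trans ?_
    have hsub : {p : (Fin n → ℝ) × (Fin n → ℝ) |
        M p.2 ≤ M p.1 ∧ M p.1 ∈ Set.Ioi t ∧ M p.2 ∈ Set.Ioi t} ⊆
        Prod.swap ⁻¹' A ∪ {p | M p.2 = M p.1} := by
      rintro p ⟨h1, h2, h3⟩
      rcases h1.lt_or_eq with h | h
      · exact Or.inl ⟨h3, h⟩
      · exact Or.inr h
    have hAm : MeasurableSet A :=
      (measurableSet_lt measurable_const hM1).inter (measurableSet_lt hM1 hM2)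
    have hz : (P.prod P).real {p | M p.2 = M p.1} = 0 := by
      rw [measureReal_def, prod_pi_sampleThreshold_eq_null hn μ]; rfl
    have hs : (P.prod P).real (Prod.swap ⁻¹' A) = (P.prod P).real A :=
      (Measure.measurePreserving_swap (μ := P) (ν := P)).measureReal_preimage
        hAm.nullMeasurableSet
    have := (measureReal_mono (μ := P.prod P) hsub).trans (measureReal_union_le _ _)
    linarith
  have hCB : C ⊆ B := fun p hp =>
    ⟨hp.2, fun i => Or.inl ((le_sampleThreshold hn p.2 i).trans hp.1)⟩
  have hdiff : (P.prod P).real (B \ C) = (P.prod P).real B - (P.prod P).real C :=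
    measureReal_sdiff hCB hCm
  have hmul : (P.prod P).real C ≤ q * (P.prod P).real B := prod_pi_le_mul_prod_pi hn μ t
  have hBC : (1 - q) * q ≤ 2 * (P.prod P).real (B \ C) := by
    rcases hq0.eq_or_lt with h | h
    · rw [← h, mul_zero]; positivity
    · refine le_of_mul_le_mul_left ?_ h
      rw [hdiff]
      nlinarith
  have hdisj : Disjoint A (B \ C) :=
    Set.disjoint_left.2 fun p hA hB => absurd hB.1.1 (not_le.2 hA.1)
  have hsub : A ∪ B \ C ⊆ {p | t < singleSampleAlg n hn p} := by
    rintro p (hp | ⟨⟨h1, h2⟩, h3⟩)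
    · exact (lt_singleSampleAlg_iff hn p t).2 (Or.inl ⟨hp.2, fun i hi => hp.1.trans hi⟩)
    · refine (lt_singleSampleAlg_iff hn p t).2 (Or.inl ⟨?_, fun i hi => ?_⟩)
      · by_contra h
        exact h3 ⟨not_lt.1 h, h1⟩
      · exact (h2 i).resolve_left (not_le.2 hi)
  have hle := measureReal_mono (μ := P.prod P) hsub
  rw [measureReal_union hdisj (hBm.diff hCm)] at hle
  rw [hq]
  nlinarith

end

/-- Single-sample prophet inequality: for independent nonnegative atomless
random variables `X_i ~ μ i` with integrable maximum, the algorithm that draws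
one sample from each distribution, sets the maximum sample as a threshold, and
(in the worst case over arrival orders, even adversarially chosen knowing all
realizations) receives the smallest real value exceeding the threshold, earns
in expectation at least half the expected maximum. -/
theorem stmt7 (n : ℕ) (hn : 0 < n) (μ : Fin n → Measure ℝ)
    (hprob : ∀ i, IsProbabilityMeasure (μ i))
    (hnonneg : ∀ i, μ i (Set.Iio 0) = 0)
    (hatomless : ∀ i, NoAtoms (μ i))
    (hfin : Integrable (fun r : Fin n → ℝ =>
      Finset.univ.sup' (Finset.univ_nonempty_iff.mpr ⟨⟨0, hn⟩⟩) r)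
      (Measure.pi μ)) :
    (1 / 2) * ∫ r : Fin n → ℝ,
        Finset.univ.sup' (Finset.univ_nonempty_iff.mpr ⟨⟨0, hn⟩⟩) r
        ∂(Measure.pi μ)
    ≤ ∫ p : (Fin n → ℝ) × (Fin n → ℝ), singleSampleAlg n hn p
        ∂((Measure.pi μ).prod (Measure.pi μ)) := by
  have : ∀ i, NullSingletonClass (μ i) := hatomless
  have hM := measurable_sampleThreshold hn
  set P := Measure.pi μ with hP
  change Integrable (sampleThreshold n hn) P at hfin
  change (1 / 2) * ∫ r, sampleThreshold n hn r ∂P ≤ _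
  have hpos : ∀ᵐ r ∂P, ∀ i, 0 ≤ r i := by
    refine ae_all_iff.2 fun i => ?_
    have : ∀ᵐ x ∂μ i, 0 ≤ x := by
      rw [ae_iff]
      simpa [Set.Iio] using hnonneg i
    exact (measurePreserving_eval μ i).quasiMeasurePreserving.ae this
  have hpos2 : ∀ᵐ p ∂P.prod P, ∀ i, 0 ≤ p.2 i :=
    Measure.quasiMeasurePreserving_snd.ae hpos
  have hMpos : 0 ≤ᵐ[P] sampleThreshold n hn := by
    filter_upwards [hpos] with r hr
    exact (hr ⟨0, hn⟩).trans (le_sampleThreshold hn r _)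
  have halg : ∀ᵐ p ∂P.prod P, 0 ≤ singleSampleAlg n hn p ∧
      singleSampleAlg n hn p ≤ sampleThreshold n hn p.2 := by
    filter_upwards [hpos2] with p hp
    rcases singleSampleAlg_eq_zero_or_mem hn p with h | ⟨i, h⟩
    · rw [h]; exact ⟨le_rfl, (hp ⟨0, hn⟩).trans (le_sampleThreshold hn _ _)⟩
    · rw [h]; exact ⟨hp i, le_sampleThreshold hn _ _⟩
  have halg0 : 0 ≤ᵐ[P.prod P] singleSampleAlg n hn := halg.mono fun p hp => hp.1
  have hint : Integrable (singleSampleAlg n hn) (P.prod P) := by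
    refine (hfin.comp_snd P).mono' (measurable_singleSampleAlg hn).aestronglyMeasurable ?_
    filter_upwards [halg] with p hp
    rw [Real.norm_of_nonneg hp.1]
    exact hp.2
  suffices h : ∫⁻ r, ENNReal.ofReal (sampleThreshold n hn r) ∂P ≤
      2 * ∫⁻ p, ENNReal.ofReal (singleSampleAlg n hn p) ∂P.prod P by
    rw [← ofReal_integral_eq_lintegral_ofReal hfin hMpos,
      ← ofReal_integral_eq_lintegral_ofReal hint halg0,
      ← ENNReal.ofReal_ofNat 2, ← ENNReal.ofReal_mul zero_le_two,
      ENNReal.ofReal_le_ofReal_iff (mul_nonneg zero_le_two (integral_nonneg_of_ae halg0))] at h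
    linarith
  rw [lintegral_eq_lintegral_meas_lt P hMpos hM.aemeasurable,
    lintegral_eq_lintegral_meas_lt _ halg0 (measurable_singleSampleAlg hn).aemeasurable,
    ← lintegral_const_mul' _ _ ENNReal.ofNat_ne_top]
  refine lintegral_mono fun t => ?_
  have := measureReal_lt_sampleThreshold_le hn μ (t := t)
  rw [measureReal_def, measureReal_def, ← ENNReal.toReal_ofNat 2, ← ENNReal.toReal_mul] at this
  exact (ENNReal.toReal_le_toReal (measure_ne_top _ _)
    (ENNReal.mul_ne_top ENNReal.ofNat_ne_top (measure_ne_top _ _))).1 this
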